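/- There exist absolute constants c > 0 and C > 0 such that the following holds. Let G = (V,E) be a non-bipartite finite vertex-transitive graph, which is d-regular. List the eigenvalues of its normalized adjacency matrix (1/d)A with multiplicity as t₁ ≤ t₂ ≤ ⋯ ≤ t_N, where N = |V|. Then for every i ≤ N−1, the eigenvalue t_i lies in the interval [−1 + c·h_out²/d, 1 − C·h_out²/d], where h_out is the outer vertex isoperimetric constant of G. -/

import Mathlib

attribute [local instance] Classical.propDecidable

/-- The outer vertex boundary of a finite set `U`: vertices outside `U` with a neighbor in `U`. -/
noncomputable def outBd {V : Type*} [Fintype V] (Adj : V → V → Prop) (U : Finset V) : Finset V :=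
  Finset.univ.filter fun y => y ∉ U ∧ ∃ x ∈ U, Adj x y

/-- The outer vertex isoperimetric constant: the minimum of `|∂_out U|/|U|` over nonempty sets
`U` with `|U| ≤ |V|/2`. -/
noncomputable def hOut {V : Type*} [Fintype V] (Adj : V → V → Prop) : ℝ :=
  sInf {r : ℝ | ∃ U : Finset V, U.Nonempty ∧ 2 * U.card ≤ Fintype.card V ∧
    r = ((outBd Adj U).card : ℝ) / (U.card : ℝ)}

/-- A graph is bipartite if the vertex set can be partitioned into two parts such that every
edge joins the two parts. -/
def Bipartite {V : Type*} (Adj : V → V → Prop) : Prop :=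
  ∃ P : V → Bool, ∀ x y, Adj x y → P x ≠ P y

/-- A graph is vertex-transitive if its automorphism group acts transitively on vertices. -/
def IsVertexTransitive {V : Type*} (Adj : V → V → Prop) : Prop :=
  ∀ x y : V, ∃ g : Equiv.Perm V, (∀ a b : V, Adj (g a) (g b) ↔ Adj a b) ∧ g x = y

section Isoperimetry

variable {V : Type*} [Fintype V] {Adj : V → V → Prop}

lemma hOut_mul_card_le (U : Finset V) (hU : 2 * U.card ≤ Fintype.card V) :
    hOut Adj * U.card ≤ (outBd Adj U).card := by
  rcases U.eq_empty_or_nonempty with rfl | hne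
  · simp
  · have hpos : (0 : ℝ) < U.card := by exact_mod_cast hne.card_pos
    rw [← le_div_iff₀ hpos]
    refine csInf_le ⟨0, ?_⟩ ⟨U, hne, hU, rfl⟩
    rintro r ⟨W, -, -, rfl⟩
    positivity

lemma hOut_nonneg : 0 ≤ hOut Adj := by
  apply Real.sInf_nonneg
  rintro r ⟨W, -, -, rfl⟩
  positivity

lemma hOut_le_two (hV : 2 ≤ Fintype.card V) : hOut Adj ≤ 2 := by
  obtain ⟨U, -, hU⟩ := Finset.exists_subset_card_eq (s := (Finset.univ : Finset V))
    (n := Fintype.card V / 2) (by rw [Finset.card_univ]; omega)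
  have h1 := hOut_mul_card_le (Adj := Adj) U (by omega)
  have h2 : (outBd Adj U).card + U.card ≤ Fintype.card V := by
    rw [← Finset.card_union_of_disjoint]
    · exact Finset.card_le_univ _
    · rw [Finset.disjoint_left]
      intro y hy
      simp only [outBd, Finset.mem_filter] at hy
      exact hy.2.1
  have h3 : (outBd Adj U).card ≤ 2 * U.card := by omega
  have h4 : ((outBd Adj U).card : ℝ) ≤ 2 * U.card := by exact_mod_cast h3
  have hpos : (0 : ℝ) < U.card := by
    have : 0 < U.card := by omega
    exact_mod_cast this
  exact le_of_mul_le_mul_right (h1.trans h4) hpos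

end Isoperimetry

section LevelSets

variable {V : Type*} [Fintype V]

open Set MeasureTheory in
/-- Layer-cake averaging over the levels `t ≥ 0` of a nonnegative function `φ`. -/
lemma exists_level_sum_indicator_le (a b c φ : V → ℝ) (κ : ℝ)
    (hab : ∀ x, a x ≤ b x) (hc : ∀ x, 0 ≤ c x) (hφ : ∀ x, 0 ≤ φ x) (hne : ∃ x, 0 < φ x)
    (h : ∑ x, ((b x - a x) + c x) ≤ κ * ∑ x, φ x) :
    ∃ t, 0 ≤ t ∧ (∃ x, t < φ x) ∧
      ∑ x, ((Ico (a x) (b x)).indicator 1 t + (Ico 0 (c x)).indicator 1 t) ≤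
        κ * ∑ x, (Ico 0 (φ x)).indicator (1 : ℝ → ℝ) t := by
  have hint : ∀ p q : ℝ, Integrable ((Ico p q).indicator (1 : ℝ → ℝ)) := by
    intro p q
    exact (integrable_indicator_iff measurableSet_Ico).2 (integrableOn_const (by simp))
  have hval : ∀ p q : ℝ, p ≤ q → ∫ t, (Ico p q).indicator (1 : ℝ → ℝ) t = q - p := by
    intro p q hpq
    rw [integral_indicator_one measurableSet_Ico, Real.volume_real_Ico_of_le hpq]
  set F : ℝ → ℝ := fun t =>
    ∑ x, ((Ico (a x) (b x)).indicator 1 t + (Ico 0 (c x)).indicator 1 t) with hF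
  set S : ℝ → ℝ := fun t => ∑ x, (Ico 0 (φ x)).indicator (1 : ℝ → ℝ) t with hS
  have hFi : Integrable F :=
    integrable_finsetSum _ fun x _ => (hint _ _).add (hint _ _)
  have hSi : Integrable S := integrable_finsetSum _ fun x _ => hint _ _
  have hFv : ∫ t, F t = ∑ x, ((b x - a x) + c x) := by
    rw [hF]
    refine (integral_finsetSum _ fun x _ => (hint _ _).add (hint _ _)).trans ?_
    refine Finset.sum_congr rfl fun x _ => ?_
    refine (integral_add (hint _ _) (hint _ _)).trans ?_
    rw [hval _ _ (hab x), hval _ _ (hc x), sub_zero]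
  have hSv : ∫ t, S t = ∑ x, φ x := by
    rw [hS, integral_finsetSum _ fun x _ => hint _ _]
    refine Finset.sum_congr rfl fun x _ => ?_
    rw [hval _ _ (hφ x), sub_zero]
  by_contra! hcon
  obtain ⟨x₀, hx₀⟩ := hne
  have hFnn : ∀ t, 0 ≤ F t := fun t => Finset.sum_nonneg fun x _ =>
    add_nonneg (indicator_nonneg (fun _ _ => zero_le_one) _)
      (indicator_nonneg (fun _ _ => zero_le_one) _)
  have hpos : ∀ t, 0 ≤ F t - κ * S t := by
    intro t
    by_cases ht : 0 ≤ t ∧ ∃ x, t < φ x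
    · exact sub_nonneg.2 (hcon t ht.1 ht.2).le
    · have : S t = 0 := by
        refine Finset.sum_eq_zero fun x _ => indicator_of_notMem ?_ _
        rintro ⟨h0, h1⟩
        exact ht ⟨h0, x, h1⟩
      rw [this, mul_zero, sub_zero]
      exact hFnn t
  have hlt : 0 < ∫ t, (F t - κ * S t) := by
    rw [integral_pos_iff_support_of_nonneg hpos (hFi.sub (hSi.const_mul κ))]
    refine lt_of_lt_of_le ?_ (measure_mono (s := Ico 0 (φ x₀)) ?_)
    · simpa using hx₀
    · intro t ht
      exact (sub_pos.2 (hcon t ht.1 ⟨x₀, ht.2⟩)).ne'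
  rw [integral_sub hFi (hSi.const_mul κ), integral_const_mul, hFv, hSv] at hlt
  linarith

/-- A Cheeger-type sweep for the signed energy `∑ (f x + s f y)²`, `s = ±1`: some level set has
few vertices `y` seeing a neighbor `x` in it that is not matched by the sign pattern. -/
lemma exists_level_card_le (Adj : V → V → Prop) (f : V → ℝ) (s θ : ℝ) (hs : s * s = 1)
    (hθ : 0 < θ) (hf : ∃ x, f x ≠ 0)
    (hE : ∑ y, ∑ x, (if Adj x y then (f x + s * f y) ^ 2 else 0) ≤ θ ^ 2 * ∑ x, f x ^ 2) :
    ∃ t, 0 ≤ t ∧ (∃ x, t < f x ^ 2) ∧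
      ((Finset.univ.filter fun y =>
        ∃ x, Adj x y ∧ t < f x ^ 2 ∧ ¬ (t < f y ^ 2 ∧ s * (f x * f y) < 0)).card : ℝ) ≤
      (2 * θ ^ 2 + 2 * θ) * (Finset.univ.filter fun x => t < f x ^ 2).card := by
  set w : V → ℝ := fun y => ∑ x, (if Adj x y then (f x + s * f y) ^ 2 else 0) with hw
  have hw0 : ∀ y, 0 ≤ w y := fun y => Finset.sum_nonneg fun x _ => by
    split_ifs <;> positivity
  set u : V → ℝ := fun y => √(w y) with hu
  have hu0 : ∀ y, 0 ≤ u y := fun y => Real.sqrt_nonneg _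
  have husq : ∀ y, u y ^ 2 = w y := fun y => Real.sq_sqrt (hw0 y)
  have hle : ∀ x y, Adj x y → (f x + s * f y) ^ 2 ≤ u y ^ 2 := by
    intro x y hxy
    rw [husq]
    have := Finset.single_le_sum (f := fun x => if Adj x y then (f x + s * f y) ^ 2 else 0)
      (s := Finset.univ) (fun x _ => by split_ifs <;> positivity) (Finset.mem_univ x)
    simpa [hxy] using this
  have hamgm : ∀ y, 2 * |f y| * u y ≤ θ * f y ^ 2 + θ⁻¹ * u y ^ 2 := by
    intro y
    have h1 : θ * f y ^ 2 + θ⁻¹ * u y ^ 2 - 2 * |f y| * u y = θ⁻¹ * (θ * |f y| - u y) ^ 2 := by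
      rw [← sq_abs (f y)]
      field_simp
      ring
    have h2 : 0 ≤ θ⁻¹ * (θ * |f y| - u y) ^ 2 := by positivity
    linarith
  obtain ⟨t, ht0, htx, ht⟩ := exists_level_sum_indicator_le (fun y => f y ^ 2)
    (fun y => f y ^ 2 + (u y ^ 2 + 2 * |f y| * u y)) (fun y => u y ^ 2) (fun y => f y ^ 2)
    (2 * θ ^ 2 + 2 * θ)
    (fun y => by have := hu0 y; simp only [le_add_iff_nonneg_right]; positivity)
    (fun y => sq_nonneg _) (fun y => sq_nonneg _)
    (by obtain ⟨x, hx⟩ := hf; exact ⟨x, by positivity⟩)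
    (by
      have hEu : ∑ y, u y ^ 2 ≤ θ ^ 2 * ∑ x, f x ^ 2 := by simpa only [husq] using hE
      calc ∑ y, (f y ^ 2 + (u y ^ 2 + 2 * |f y| * u y) - f y ^ 2 + u y ^ 2)
          ≤ ∑ y, (θ * f y ^ 2 + (2 + θ⁻¹) * u y ^ 2) :=
            Finset.sum_le_sum fun y _ => by linarith [hamgm y]
        _ = θ * ∑ y, f y ^ 2 + (2 + θ⁻¹) * ∑ y, u y ^ 2 := by
            rw [Finset.sum_add_distrib, Finset.mul_sum, Finset.mul_sum]
        _ ≤ θ * ∑ y, f y ^ 2 + (2 + θ⁻¹) * (θ ^ 2 * ∑ x, f x ^ 2) := by gcongr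
        _ = (2 * θ ^ 2 + 2 * θ) * ∑ x, f x ^ 2 := by field_simp; ring)
  refine ⟨t, ht0, htx, ?_⟩
  have hS : ((Finset.univ.filter fun x => t < f x ^ 2).card : ℝ) =
      ∑ x, (Set.Ico 0 (f x ^ 2)).indicator (1 : ℝ → ℝ) t := by
    simp [Set.indicator_apply, ht0]
  rw [hS]
  refine le_trans ?_ ht
  rw [Finset.card_filter, Nat.cast_sum]
  refine Finset.sum_le_sum fun y _ => ?_
  have hi : ∀ A : Set ℝ, 0 ≤ A.indicator (1 : ℝ → ℝ) t := fun A =>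
    Set.indicator_nonneg (fun _ _ => zero_le_one) _
  split_ifs with hy
  · obtain ⟨x, hxy, htx, hn⟩ := hy
    have h1 := hle x y hxy
    by_cases hty : t < f y ^ 2
    · have h2 : 0 ≤ s * (f x * f y) := by
        by_contra! h
        exact hn ⟨hty, h⟩
      have h3 : t < u y ^ 2 := by
        nlinarith [sq_nonneg (s * f y)]
      rw [Set.indicator_of_mem (show t ∈ Set.Ico 0 (u y ^ 2) from ⟨ht0, h3⟩)]
      simpa using hi _
    · have h2 : |f x + s * f y| ≤ u y := abs_le_of_sq_le_sq h1 (hu0 y)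
      have h3 : f x ^ 2 ≤ f y ^ 2 + (u y ^ 2 + 2 * |f y| * u y) := by
        have hs1 : |s| = 1 := by
          have : |s| * |s| = 1 := by rw [← abs_mul, hs, abs_one]
          nlinarith [abs_nonneg s]
        have h4 : |f x| ≤ u y + |f y| := by
          calc |f x| = |(f x + s * f y) - s * f y| := by ring_nf
            _ ≤ |f x + s * f y| + |s * f y| := abs_sub _ _
            _ ≤ u y + |f y| := by rw [abs_mul, hs1, one_mul]; gcongr
        have h5 : |f x| ^ 2 ≤ (u y + |f y|) ^ 2 := by gcongr
        rw [← sq_abs (f x), ← sq_abs (f y)]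
        linarith
      rw [Set.indicator_of_mem (show t ∈ Set.Ico (f y ^ 2) (f y ^ 2 + (u y ^ 2 + 2 * |f y| * u y))
        from ⟨not_lt.1 hty, htx.trans_le h3⟩)]
      simpa using hi _
  · simpa using add_nonneg (hi _) (hi _)

end LevelSets

section SignPatterns

variable {Γ V : Type*} [Fintype V]

/-- A partial sign pattern that is almost preserved up to sign by a transitive group is close to
a sign pattern that is exactly equivariant. -/
lemma exists_equivariant_sign [Group Γ] [Fintype Γ] [Nonempty V] [MulAction Γ V]
    [MulAction.IsPretransitive Γ V] (φ : V → ℤ) (hφ : ∀ x, φ x = 0 ∨ φ x = 1 ∨ φ x = -1)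
    (χ : Γ → ℤ) (hχ : ∀ g, χ g = 1 ∨ χ g = -1)
    (hD : ∀ g : Γ, 40 * (Finset.univ.filter fun x => φ (g • x) ≠ χ g * φ x ∨ φ x = 0).card ≤
      8 * Fintype.card V) :
    ∃ s : V → ℤ, (∀ x, s x = 1 ∨ s x = -1) ∧ (∀ (g : Γ) x, s (g • x) = χ g * s x) ∧
      40 * (Finset.univ.filter fun x => φ x ≠ s x).card ≤ 16 * Fintype.card V := by
  have hN : 0 < Fintype.card V := Fintype.card_pos
  have hsq : ∀ g, χ g * χ g = 1 := fun g => by rcases hχ g with h | h <;> simp [h]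
  have hmul : ∀ g h, χ (g * h) = χ g * χ h := by
    intro g h
    set A := Finset.univ.filter fun x => φ (h • x) ≠ χ h * φ x ∨ φ x = 0
    set B := Finset.univ.filter fun x => φ (g • x) ≠ χ g * φ x ∨ φ x = 0 with hB
    set B' := Finset.univ.filter fun x => h • x ∈ B with hB'
    set C := Finset.univ.filter fun x => φ ((g * h) • x) ≠ χ (g * h) * φ x ∨ φ x = 0
    have hBB : B'.card = B.card :=
      Finset.card_equiv (MulAction.toPerm h) fun x => by simp [hB']
    have h1 : (A ∪ B' ∪ C).card < Fintype.card V := by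
      have h2 := Finset.card_union_le (A ∪ B') C
      have h3 := Finset.card_union_le A B'
      have h4 : 40 * A.card ≤ 8 * Fintype.card V := hD h
      have h5 : 40 * B.card ≤ 8 * Fintype.card V := hD g
      have h6 : 40 * C.card ≤ 8 * Fintype.card V := hD (g * h)
      omega
    obtain ⟨x, hx⟩ : ∃ x, x ∉ A ∪ B' ∪ C := by
      by_contra! hall
      rw [Finset.eq_univ_iff_forall.2 hall, Finset.card_univ] at h1
      exact lt_irrefl _ h1
    simp only [Finset.mem_union, not_or] at hx
    obtain ⟨⟨hA, hBx⟩, hC⟩ := hx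
    simp only [A, B, B', C, Finset.mem_filter, Finset.mem_univ, true_and, not_or,
      not_not] at hA hBx hC
    have h7 : χ (g * h) * φ x = χ g * χ h * φ x := by
      rw [← hC.1, mul_smul, hBx.1, hA.1, mul_assoc]
    exact mul_right_cancel₀ hA.2 h7
  set F : V → ℤ := fun x => ∑ g : Γ, χ g * φ (g • x) with hF
  have hFeq : ∀ (h : Γ) x, F (h • x) = χ h * F x := by
    intro h x
    rw [hF]
    simp only
    rw [← Equiv.sum_comp (Equiv.mulRight h) (fun g => χ g * φ (g • x)), Finset.mul_sum]
    refine Finset.sum_congr rfl fun g _ => ?_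
    rw [Equiv.coe_mulRight, hmul, mul_smul]
    linear_combination (-χ g * φ (g • h • x)) * hsq h
  obtain ⟨x₀⟩ := ‹Nonempty V›
  have habs : ∀ x, |F x| = |F x₀| := by
    intro x
    obtain ⟨g, rfl⟩ := MulAction.exists_smul_eq Γ x₀ x
    rw [hFeq, abs_mul]
    rcases hχ g with h | h <;> simp [h]
  have hφabs : ∀ x, |φ x| ≤ 1 := fun x => by rcases hφ x with h | h | h <;> simp [h]
  have hle : |F x₀| ≤ Fintype.card Γ := by
    refine (Finset.abs_sum_le_sum_abs _ _).trans ?_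
    refine (Finset.sum_le_card_nsmul _ _ 1 fun g _ => ?_).trans (by simp)
    rw [abs_mul]
    rcases hχ g with h | h <;> simp [h, hφabs]
  have hlow : 24 * (Fintype.card V : ℤ) * Fintype.card Γ ≤ 40 * ∑ x, φ x * F x := by
    have h1 : ∑ x, φ x * F x = ∑ g : Γ, ∑ x, χ g * (φ x * φ (g • x)) := by
      rw [Finset.sum_comm]
      refine Finset.sum_congr rfl fun x _ => ?_
      rw [hF, Finset.mul_sum]
      exact Finset.sum_congr rfl fun g _ => by ring
    have h2 : ∀ g : Γ, 24 * (Fintype.card V : ℤ) ≤ 40 * ∑ x, χ g * (φ x * φ (g • x)) := by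
      intro g
      have h3 : ∀ x, 1 - 2 * (if φ (g • x) ≠ χ g * φ x ∨ φ x = 0 then (1 : ℤ) else 0) ≤
          χ g * (φ x * φ (g • x)) := by
        intro x
        split_ifs with h
        · have h4 : |χ g * (φ x * φ (g • x))| ≤ 1 := by
            rw [abs_mul, abs_mul]
            have := mul_le_one₀ (hφabs x) (abs_nonneg _) (hφabs (g • x))
            rcases hχ g with h | h <;> simpa [h] using this
          have := (abs_le.1 h4).1
          linarith
        · push Not at h
          rw [h.1]
          rcases hφ x with h5 | h5 | h5
          · exact absurd h5 h.2
          · rw [h5]; linarith [hsq g]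
          · rw [h5]; linarith [hsq g]
      have h4 := Finset.sum_le_sum fun x (_ : x ∈ Finset.univ) => h3 x
      rw [Finset.sum_sub_distrib, ← Finset.mul_sum, Finset.sum_boole] at h4
      have h5 := hD g
      zify at h5
      simp only [Finset.sum_const, Finset.card_univ, nsmul_eq_mul, mul_one] at h4
      linarith
    rw [h1, Finset.mul_sum]
    refine le_trans ?_ (Finset.sum_le_sum fun g _ => h2 g)
    simp [mul_comm]
  have hΓ : 0 < Fintype.card Γ := Fintype.card_pos
  have hc : 0 < |F x₀| := by
    by_contra! h
    have h0 : ∀ x, F x = 0 := fun x => abs_nonpos_iff.1 ((habs x).trans_le h)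
    simp only [h0, mul_zero, Finset.sum_const_zero] at hlow
    have : 0 < 24 * (Fintype.card V : ℤ) * Fintype.card Γ := by positivity
    linarith
  have hF0 : ∀ x, F x ≠ 0 := fun x => abs_pos.1 ((habs x).symm ▸ hc)
  have hsgn : ∀ x, (F x).sign = 1 ∨ (F x).sign = -1 := by
    intro x
    rcases lt_or_gt_of_ne (hF0 x) with h | h
    · exact Or.inr (Int.sign_eq_neg_one_of_neg h)
    · exact Or.inl (Int.sign_eq_one_of_pos h)
  refine ⟨fun x => (F x).sign, hsgn, ?_, ?_⟩
  · intro g x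
    simp only
    rw [hFeq, Int.sign_mul]
    rcases hχ g with h | h <;> simp [h]
  · have h1 : ∀ x, φ x * F x ≤ |F x₀| * (1 - if φ x ≠ (F x).sign then 1 else 0) := by
      intro x
      have h2 : F x = |F x₀| * (F x).sign := by
        rw [← habs x, mul_comm, Int.sign_mul_abs]
      have h3 : φ x * (F x).sign ≤ (1 - if φ x ≠ (F x).sign then 1 else 0) := by
        rcases hsgn x with h | h <;> rcases hφ x with h' | h' | h' <;> simp [h, h']
      calc φ x * F x = |F x₀| * (φ x * (F x).sign) := by
            conv_lhs => rw [h2]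
            ring
        _ ≤ _ := by gcongr
    have h2 := Finset.sum_le_sum fun x (_ : x ∈ Finset.univ) => h1 x
    rw [← Finset.mul_sum, Finset.sum_sub_distrib, Finset.sum_boole] at h2
    simp only [Finset.sum_const, Finset.card_univ, nsmul_eq_mul, mul_one] at h2
    set D := (Finset.univ.filter fun x => φ x ≠ (F x).sign).card
    have hDN : (D : ℤ) ≤ Fintype.card V := by exact_mod_cast Finset.card_le_univ _
    have h3 : |F x₀| * ((Fintype.card V : ℤ) - D) ≤
        Fintype.card Γ * ((Fintype.card V : ℤ) - D) :=
      mul_le_mul_of_nonneg_right hle (by linarith)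
    have h4 : 24 * (Fintype.card V : ℤ) * Fintype.card Γ ≤
        40 * ((Fintype.card V : ℤ) - D) * Fintype.card Γ := by
      have h2' : ∑ x, φ x * F x ≤ |F x₀| * ((Fintype.card V : ℤ) - D) := by exact_mod_cast h2
      linarith
    have h5 := le_of_mul_le_mul_right h4 (by exact_mod_cast hΓ)
    have h6 : 40 * (D : ℤ) ≤ 16 * Fintype.card V := by linarith
    exact_mod_cast h6

end SignPatterns

section Automorphisms

variable {V : Type*}

/-- The automorphism group of a relation, as a group of permutations. -/
def adjAut (Adj : V → V → Prop) : Subgroup (Equiv.Perm V) where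
  carrier := {g | ∀ a b, Adj (g a) (g b) ↔ Adj a b}
  mul_mem' {g h} hg hh a b := (hg (h a) (h b)).trans (hh a b)
  one_mem' _ _ := Iff.rfl
  inv_mem' {g} hg a b := by simpa using (hg (g⁻¹ a) (g⁻¹ b)).symm

lemma adjAut_adj_smul_iff {Adj : V → V → Prop} (g : adjAut Adj) (a b : V) :
    Adj (g • a) (g • b) ↔ Adj a b :=
  g.2 a b

lemma IsVertexTransitive.isPretransitive {Adj : V → V → Prop} (h : IsVertexTransitive Adj) :
    MulAction.IsPretransitive (adjAut Adj) V where
  exists_smul_eq x y := by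
    obtain ⟨g, hg, hxy⟩ := h x y
    exact ⟨⟨g, hg⟩, hxy⟩

variable [Fintype V]

/-- The vertices that see the support of the sign pattern `φ` but do not carry the sign
opposite to the one they see. -/
noncomputable def unmatched (Adj : V → V → Prop) (φ : V → ℤ) : Finset V :=
  Finset.univ.filter fun y => ∃ x, Adj x y ∧ φ x ≠ 0 ∧ φ y ≠ -φ x

lemma eq_neg_of_notMem_unmatched {Adj : V → V → Prop} {φ : V → ℤ} {x y : V}
    (hy : y ∉ unmatched Adj φ) (hxy : Adj x y) (hx : φ x ≠ 0) : φ y = -φ x := by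
  by_contra h
  exact hy (Finset.mem_filter.2 ⟨Finset.mem_univ _, x, hxy, hx, h⟩)

/-- Each automorphism almost preserves or almost reverses a sign pattern with few unmatched
vertices. -/
lemma exists_sign_card_le {Adj : V → V → Prop} (hpos : 0 < hOut Adj) (φ : V → ℤ)
    (hφ : ∀ x, φ x = 0 ∨ φ x = 1 ∨ φ x = -1)
    (hB : 40 * ((unmatched Adj φ).card : ℝ) ≤ hOut Adj * Fintype.card V)
    (hZ : 40 * (Finset.univ.filter fun x => φ x = 0).card ≤ 3 * Fintype.card V)
    (g : adjAut Adj) :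
    ∃ χ : ℤ, (χ = 1 ∨ χ = -1) ∧
      40 * (Finset.univ.filter fun x => φ (g • x) ≠ χ * φ x ∨ φ x = 0).card ≤
        8 * Fintype.card V := by
  set B := unmatched Adj φ with hBdef
  set gB := Finset.univ.filter fun x => g • x ∈ B with hgB
  have hgBc : gB.card = B.card :=
    Finset.card_equiv (MulAction.toPerm g) fun x => by simp [hgB]
  set Z := Finset.univ.filter fun x => φ x = 0 with hZdef
  set gZ := Finset.univ.filter fun x => g • x ∈ Z with hgZ
  have hgZc : gZ.card = Z.card :=
    Finset.card_equiv (MulAction.toPerm g) fun x => by simp [hgZ]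
  set X : ℤ → Finset V := fun ε => Finset.univ.filter fun x => φ x * φ (g • x) = ε with hX
  have hbd : ∀ ε, ε ≠ 0 → outBd Adj (X ε) ⊆ B ∪ gB := by
    intro ε hε y hy
    simp only [outBd, hX, Finset.mem_filter, Finset.mem_univ, true_and] at hy
    obtain ⟨hyX, x, hx, hxy⟩ := hy
    by_contra hn
    simp only [Finset.mem_union, hgB, Finset.mem_filter, Finset.mem_univ, true_and,
      not_or] at hn
    have hx0 : φ x ≠ 0 := fun h => hε (by rw [← hx, h, zero_mul])
    have hgx0 : φ (g • x) ≠ 0 := fun h => hε (by rw [← hx, h, mul_zero])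
    have h1 := eq_neg_of_notMem_unmatched hn.1 hxy hx0
    have h2 := eq_neg_of_notMem_unmatched hn.2 ((adjAut_adj_smul_iff g x y).2 hxy) hgx0
    apply hyX
    rw [h1, h2, neg_mul_neg, hx]
  have hsmall : ∀ ε, ε ≠ 0 → 2 * (X ε).card ≤ Fintype.card V →
      40 * (X ε).card ≤ 2 * Fintype.card V := by
    intro ε hε h2
    have h3 := hOut_mul_card_le (Adj := Adj) _ h2
    have h4 : (outBd Adj (X ε)).card ≤ 2 * B.card := by
      have h5 := Finset.card_le_card (hbd ε hε)
      have h6 := Finset.card_union_le B gB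
      omega
    have h5 : ((outBd Adj (X ε)).card : ℝ) ≤ 2 * B.card := by exact_mod_cast h4
    have h6 : hOut Adj * (40 * ((X ε).card : ℝ)) ≤ hOut Adj * (2 * Fintype.card V) := by
      linarith
    have h7 := le_of_mul_le_mul_left h6 hpos
    exact_mod_cast h7
  have hcover : ∀ ε : ℤ, (ε = 1 ∨ ε = -1) →
      (Finset.univ.filter fun x => φ (g • x) ≠ ε * φ x ∨ φ x = 0) ⊆ X (-ε) ∪ (Z ∪ gZ) := by
    intro ε hε x hx
    simp only [Finset.mem_filter, Finset.mem_univ, true_and] at hx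
    simp only [hX, hgZ, hZdef, Finset.mem_union, Finset.mem_filter, Finset.mem_univ, true_and]
    rcases hε with rfl | rfl <;> rcases hφ x with h | h | h <;>
      rcases hφ (g • x) with h' | h' | h' <;> simp [h, h'] at hx ⊢
  have hfin : ∀ ε : ℤ, (ε = 1 ∨ ε = -1) → 2 * (X (-ε)).card ≤ Fintype.card V →
      40 * (Finset.univ.filter fun x => φ (g • x) ≠ ε * φ x ∨ φ x = 0).card ≤
        8 * Fintype.card V := by
    intro ε hε h2
    have h3 := hsmall (-ε) (by rcases hε with rfl | rfl <;> simp) h2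
    have h4 := Finset.card_le_card (hcover ε hε)
    have h5 := Finset.card_union_le (X (-ε)) (Z ∪ gZ)
    have h6 := Finset.card_union_le Z gZ
    omega
  have hdisj : (X 1).card + (X (-1)).card ≤ Fintype.card V := by
    rw [← Finset.card_union_of_disjoint]
    · exact Finset.card_le_univ _
    · rw [Finset.disjoint_left]
      intro x h1 h2
      simp only [hX, Finset.mem_filter, Finset.mem_univ, true_and] at h1 h2
      omega
  by_cases h : 2 * (X (-1)).card ≤ Fintype.card V
  · exact ⟨1, Or.inl rfl, hfin 1 (Or.inl rfl) h⟩
  · exact ⟨-1, Or.inr rfl, hfin (-1) (Or.inr rfl) (by rw [neg_neg]; omega)⟩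

/-- If some sign pattern on an expanding graph has few unmatched vertices, then it vanishes
only on a small set. -/
lemma card_zero_le {Adj : V → V → Prop} (hsymm : ∀ x y, Adj x y → Adj y x)
    (hV : 2 ≤ Fintype.card V) (hpos : 0 < hOut Adj) (φ : V → ℤ) (hne : ∃ x, φ x ≠ 0)
    (hB : 40 * ((unmatched Adj φ).card : ℝ) ≤
      hOut Adj * (Finset.univ.filter fun x => φ x ≠ 0).card) :
    40 * (Finset.univ.filter fun x => φ x = 0).card ≤ 3 * Fintype.card V := by
  have htwo := hOut_le_two (Adj := Adj) hV
  set B := unmatched Adj φ with hBdef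
  set S := Finset.univ.filter fun x => φ x ≠ 0 with hS
  set Z := Finset.univ.filter fun x => φ x = 0 with hZ
  have hSpos : (0 : ℝ) < S.card := by
    obtain ⟨x, hx⟩ := hne
    exact_mod_cast Finset.card_pos.2 ⟨x, Finset.mem_filter.2 ⟨Finset.mem_univ _, hx⟩⟩
  have hSN : S.card ≤ Fintype.card V := Finset.card_le_univ _
  have hSZ : Z.card + S.card = Fintype.card V := by
    rw [hZ, hS, Finset.card_filter_add_card_filter_not, Finset.card_univ]
  have hSbd : outBd Adj S ⊆ B := by
    intro y hy
    simp only [outBd, hS, Finset.mem_filter, Finset.mem_univ, true_and, not_not] at hy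
    obtain ⟨hy0, x, hx, hxy⟩ := hy
    by_contra hyB
    have := eq_neg_of_notMem_unmatched hyB hxy hx
    omega
  have hSbig : Fintype.card V < 2 * S.card := by
    by_contra! h
    have h1 := hOut_mul_card_le (Adj := Adj) S h
    have h2 : ((outBd Adj S).card : ℝ) ≤ B.card := by
      exact_mod_cast Finset.card_le_card hSbd
    have h3 := mul_pos hpos hSpos
    linarith
  have hZbd : outBd Adj (Z \ B) ⊆ B := by
    intro y hy
    simp only [outBd, hZ, Finset.mem_filter, Finset.mem_univ, true_and, Finset.mem_sdiff] at hy
    obtain ⟨hy1, x, ⟨hx0, hxB⟩, hxy⟩ := hy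
    by_contra hyB
    have hy0 : φ y ≠ 0 := fun h => hy1 ⟨h, hyB⟩
    have := eq_neg_of_notMem_unmatched hxB (hsymm _ _ hxy) hy0
    omega
  have hZB : (Z \ B).card ≤ Z.card := Finset.card_le_card Finset.sdiff_subset
  have h1 := hOut_mul_card_le (Adj := Adj) (Z \ B) (by omega)
  have h2 : ((outBd Adj (Z \ B)).card : ℝ) ≤ B.card := by
    exact_mod_cast Finset.card_le_card hZbd
  have hSN' : (S.card : ℝ) ≤ Fintype.card V := by exact_mod_cast hSN
  have h3 : hOut Adj * (40 * ((Z \ B).card : ℝ)) ≤ hOut Adj * Fintype.card V := by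
    have := mul_le_mul_of_nonneg_left hSN' hpos.le
    linarith
  have h4 : 40 * (Z \ B).card ≤ Fintype.card V := by
    exact_mod_cast le_of_mul_le_mul_left h3 hpos
  have h5 : 40 * B.card ≤ 2 * Fintype.card V := by
    have : 40 * (B.card : ℝ) ≤ 2 * Fintype.card V := by
      have := mul_le_mul htwo hSN' hSpos.le zero_le_two
      linarith
    exact_mod_cast this
  have h6 : Z.card ≤ (Z \ B).card + B.card := by
    have := Finset.le_card_sdiff B Z
    omega
  omega

/-- A vertex-transitive graph carrying a sign pattern with few unmatched vertices, relative to
its expansion, is bipartite. -/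
theorem IsVertexTransitive.bipartite_of_card_unmatched_le {Adj : V → V → Prop}
    (hvt : IsVertexTransitive Adj) (hsymm : ∀ x y, Adj x y → Adj y x)
    (hV : 2 ≤ Fintype.card V) (hpos : 0 < hOut Adj) (φ : V → ℤ)
    (hφ : ∀ x, φ x = 0 ∨ φ x = 1 ∨ φ x = -1) (hne : ∃ x, φ x ≠ 0)
    (hB : 40 * ((unmatched Adj φ).card : ℝ) ≤
      hOut Adj * (Finset.univ.filter fun x => φ x ≠ 0).card) :
    Bipartite Adj := by
  have htwo := hOut_le_two (Adj := Adj) hV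
  have hZ := card_zero_le hsymm hV hpos φ hne hB
  have hBN : 40 * ((unmatched Adj φ).card : ℝ) ≤ hOut Adj * Fintype.card V := by
    refine hB.trans (mul_le_mul_of_nonneg_left ?_ hpos.le)
    exact_mod_cast Finset.card_le_univ _
  have hB2 : 40 * (unmatched Adj φ).card ≤ 2 * Fintype.card V := by
    have : 40 * ((unmatched Adj φ).card : ℝ) ≤ 2 * Fintype.card V :=
      hBN.trans (by gcongr)
    exact_mod_cast this
  choose χ hχ hD using exists_sign_card_le hpos φ hφ hBN hZ
  have := hvt.isPretransitive
  have : Nonempty V := ⟨hne.choose⟩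
  obtain ⟨s, hs, hsχ, hsD⟩ := exists_equivariant_sign φ hφ χ hχ hD
  set B := unmatched Adj φ
  set D := Finset.univ.filter fun x => φ x ≠ s x with hDdef
  set K : V → Finset V := fun x => Finset.univ.filter fun y => Adj x y ∧ s x = s y with hK
  obtain ⟨x₀⟩ := ‹Nonempty V›
  have hKc : ∀ x, (K x).card = (K x₀).card := by
    intro x
    obtain ⟨g, rfl⟩ := MulAction.exists_smul_eq (adjAut Adj) x₀ x
    symm
    refine Finset.card_equiv (MulAction.toPerm g) fun y => ?_
    simp only [hK, Finset.mem_filter, Finset.mem_univ, true_and, MulAction.toPerm_apply,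
      adjAut_adj_smul_iff, hsχ]
    rcases hχ g with h | h <;> simp [h]
  rcases Nat.eq_zero_or_pos (K x₀).card with h0 | hk
  · refine ⟨fun x => decide (s x = 1), fun x y hxy hP => ?_⟩
    have hxK : y ∉ K x := by
      rw [Finset.card_eq_zero.1 ((hKc x).trans h0)]
      exact Finset.notMem_empty y
    apply hxK
    simp only [hK, Finset.mem_filter, Finset.mem_univ, true_and]
    refine ⟨hxy, ?_⟩
    have hP' : s x = 1 ↔ s y = 1 := by simpa using hP
    rcases hs x with h | h <;> rcases hs y with h' | h' <;> simp_all
  · exfalso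
    have hsub : (Finset.univ.sigma K) ⊆
        (D.sigma K) ∪ ((D ∪ B).sigma K).map
          ((Equiv.sigmaEquivProd V V).trans
            ((Equiv.prodComm V V).trans (Equiv.sigmaEquivProd V V).symm)).toEmbedding := by
      rintro ⟨x, y⟩ hxy
      simp only [Finset.mem_sigma, Finset.mem_univ, true_and] at hxy
      have hxy' := hxy
      simp only [hK, Finset.mem_filter, Finset.mem_univ, true_and] at hxy'
      rw [Finset.mem_union]
      by_cases hxD : x ∈ D
      · exact Or.inl (Finset.mem_sigma.2 ⟨hxD, hxy⟩)
      · right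
        refine Finset.mem_map.2 ⟨⟨y, x⟩, Finset.mem_sigma.2 ⟨?_, ?_⟩, rfl⟩
        · simp only [Finset.mem_union]
          by_contra! hn
          have hx : φ x = s x := by simpa [hDdef] using hxD
          have hy : φ y = s y := by simpa [hDdef] using hn.1
          have hx0 : φ x ≠ 0 := by rcases hs x with h | h <;> simp [hx, h]
          have := eq_neg_of_notMem_unmatched hn.2 hxy'.1 hx0
          have := hxy'.2
          omega
        · simp only [hK, Finset.mem_filter, Finset.mem_univ, true_and]
          exact ⟨hsymm _ _ hxy'.1, hxy'.2.symm⟩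
    have hcard := (Finset.card_le_card hsub).trans (Finset.card_union_le _ _)
    rw [Finset.card_map, Finset.card_sigma, Finset.card_sigma, Finset.card_sigma,
      Finset.sum_congr rfl fun x _ => hKc x, Finset.sum_congr rfl fun x _ => hKc x,
      Finset.sum_congr rfl fun x _ => hKc x] at hcard
    simp only [Finset.sum_const, smul_eq_mul, ← add_mul, Finset.card_univ] at hcard
    have h1 := Nat.le_of_mul_le_mul_right hcard hk
    have h2 := Finset.card_union_le D B
    omega

end Automorphisms

section Spectral

variable {V : Type*} [Fintype V] {Adj : V → V → Prop} {d : ℕ}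

lemma sum_adj_sq_eq (hsymm : ∀ x y, Adj x y → Adj y x)
    (hd : ∀ x, (Finset.univ.filter fun y => Adj x y).card = d) (f : V → ℝ) (s : ℝ)
    (hs : s * s = 1) :
    ∑ y, ∑ x, (if Adj x y then (f x + s * f y) ^ 2 else 0) =
      2 * (d * ∑ x, f x ^ 2 + s * ∑ y, f y * ∑ x, if Adj x y then f x else 0) := by
  have hdeg : ∀ x, ∑ y, (if Adj x y then (1 : ℝ) else 0) = d := by
    intro x
    rw [Finset.sum_boole, hd]
  have hdeg' : ∀ y, ∑ x, (if Adj x y then (1 : ℝ) else 0) = d := by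
    intro y
    rw [← hdeg y]
    exact Finset.sum_congr rfl fun x _ => if_congr ⟨hsymm _ _, hsymm _ _⟩ rfl rfl
  have h1 : ∀ y x, (if Adj x y then (f x + s * f y) ^ 2 else 0) =
      f x ^ 2 * (if Adj x y then 1 else 0) + f y ^ 2 * (if Adj x y then 1 else 0) +
        2 * s * (f y * if Adj x y then f x else 0) := by
    intro y x
    split_ifs
    · linear_combination f y ^ 2 * hs
    · simp
  simp only [h1, Finset.sum_add_distrib, ← Finset.mul_sum, hdeg']
  rw [Finset.sum_comm]
  simp only [← Finset.mul_sum, hdeg, ← Finset.sum_mul]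
  ring

lemma abs_eigenvalue_le (hsymm : ∀ x y, Adj x y → Adj y x)
    (hd : ∀ x, (Finset.univ.filter fun y => Adj x y).card = d) (f : V → ℝ)
    (hf : ∃ x, f x ≠ 0) (μ : ℝ) (hμ : ∀ y, ∑ x, (if Adj x y then f x else 0) = μ * f y) :
    |μ| ≤ d := by
  have hF : 0 < ∑ x, f x ^ 2 := by
    obtain ⟨x, hx⟩ := hf
    exact Finset.sum_pos' (fun _ _ => sq_nonneg _) ⟨x, Finset.mem_univ _, by positivity⟩
  have key : ∀ s : ℝ, s * s = 1 → 0 ≤ (d + s * μ) := by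
    intro s hs
    have h0 : 0 ≤ ∑ y, ∑ x, (if Adj x y then (f x + s * f y) ^ 2 else 0) :=
      Finset.sum_nonneg fun _ _ => Finset.sum_nonneg fun _ _ => by split_ifs <;> positivity
    rw [sum_adj_sq_eq hsymm hd f s hs] at h0
    have h1 : ∑ y, f y * ∑ x, (if Adj x y then f x else 0) = μ * ∑ x, f x ^ 2 := by
      rw [Finset.mul_sum]
      exact Finset.sum_congr rfl fun y _ => by rw [hμ]; ring
    rw [h1] at h0
    by_contra! h
    have := mul_neg_of_neg_of_pos h hF
    linarith
  have h1 := key 1 (by norm_num)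
  have h2 := key (-1) (by norm_num)
  rw [abs_le]
  constructor <;> linarith

/-- The sweep constant at the scale `θ = h / 200` is small compared to `h`. -/
lemma sweep_constant_le {h : ℝ} (h0 : 0 ≤ h) (h2 : h ≤ 2) :
    40 * (2 * (h / 200) ^ 2 + 2 * (h / 200)) ≤ h := by
  nlinarith

/-- Lower spectral bound. -/
lemma hOut_sq_le_add_eigenvalue (hvt : IsVertexTransitive Adj)
    (hsymm : ∀ x y, Adj x y → Adj y x) (hV : 2 ≤ Fintype.card V) (hnb : ¬ Bipartite Adj)
    (hd : ∀ x, (Finset.univ.filter fun y => Adj x y).card = d) (f : V → ℝ)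
    (hf : ∃ x, f x ≠ 0) (μ : ℝ) (hμ : ∀ y, ∑ x, (if Adj x y then f x else 0) = μ * f y) :
    hOut Adj ^ 2 / 80000 ≤ d + μ := by
  rcases (hOut_nonneg (Adj := Adj)).eq_or_lt with h0 | hpos
  · rw [← h0]
    have := (abs_le.1 (abs_eigenvalue_le hsymm hd f hf μ hμ)).1
    linarith
  have htwo := hOut_le_two (Adj := Adj) hV
  by_contra! hlt
  have hE : ∑ y, ∑ x, (if Adj x y then (f x + 1 * f y) ^ 2 else 0) ≤
      (hOut Adj / 200) ^ 2 * ∑ x, f x ^ 2 := by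
    have h1 : ∑ y, f y * ∑ x, (if Adj x y then f x else 0) = μ * ∑ x, f x ^ 2 := by
      rw [Finset.mul_sum]
      exact Finset.sum_congr rfl fun y _ => by rw [hμ]; ring
    rw [sum_adj_sq_eq hsymm hd f 1 (by norm_num), h1]
    have hF : 0 ≤ ∑ x, f x ^ 2 := Finset.sum_nonneg fun _ _ => sq_nonneg _
    have := mul_le_mul_of_nonneg_right hlt.le hF
    linarith
  obtain ⟨t, ht0, ⟨x₁, hx₁⟩, ht⟩ :=
    exists_level_card_le Adj f 1 (hOut Adj / 200) (by norm_num) (by positivity) hf hE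
  set φ : V → ℤ := fun x => if t < f x ^ 2 then (if 0 < f x then 1 else -1) else 0 with hφdef
  have hφ0 : ∀ x, φ x ≠ 0 ↔ t < f x ^ 2 := by
    intro x
    simp only [hφdef]
    split_ifs <;> simp_all
  apply hnb
  refine hvt.bipartite_of_card_unmatched_le hsymm hV hpos φ (fun x => ?_)
    ⟨x₁, (hφ0 x₁).2 hx₁⟩ ?_
  · simp only [hφdef]
    split_ifs <;> simp
  · have hsub : unmatched Adj φ ⊆ Finset.univ.filter fun y =>
        ∃ x, Adj x y ∧ t < f x ^ 2 ∧ ¬ (t < f y ^ 2 ∧ 1 * (f x * f y) < 0) := by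
      intro y hy
      simp only [unmatched, Finset.mem_filter, Finset.mem_univ, true_and] at hy ⊢
      obtain ⟨x, hxy, hx, hne⟩ := hy
      refine ⟨x, hxy, (hφ0 x).1 hx, ?_⟩
      rintro ⟨hty, hneg⟩
      apply hne
      rw [one_mul, mul_neg_iff] at hneg
      have htx := (hφ0 x).1 hx
      rcases hneg with ⟨h1, h2⟩ | ⟨h1, h2⟩
      · simp [hφdef, htx, hty, h1, h2.not_gt]
      · simp [hφdef, htx, hty, h1.not_gt, h2]
    have h1 : ((unmatched Adj φ).card : ℝ) ≤ _ :=
      (Nat.cast_le.2 (Finset.card_le_card hsub)).trans ht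
    simp only [hφ0]
    have h2 := mul_le_mul_of_nonneg_right (sweep_constant_le hpos.le htwo)
      (Nat.cast_nonneg (α := ℝ) (Finset.univ.filter fun x => t < f x ^ 2).card)
    linarith

lemma hOut_sq_le_sub_eigenvalue_of_card_pos_le (hsymm : ∀ x y, Adj x y → Adj y x)
    (hV : 2 ≤ Fintype.card V)
    (hd : ∀ x, (Finset.univ.filter fun y => Adj x y).card = d) (f : V → ℝ)
    (hf : ∃ x, 0 < f x) (hcard : 2 * (Finset.univ.filter fun x => 0 < f x).card ≤ Fintype.card V)
    (μ : ℝ) (hμ : ∀ y, ∑ x, (if Adj x y then f x else 0) = μ * f y) :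
    hOut Adj ^ 2 / 80000 ≤ d - μ := by
  obtain ⟨x₀, hx₀⟩ := hf
  rcases (hOut_nonneg (Adj := Adj)).eq_or_lt with h0 | hpos
  · rw [← h0]
    have := (abs_le.1 (abs_eigenvalue_le hsymm hd f ⟨x₀, hx₀.ne'⟩ μ hμ)).2
    linarith
  have htwo := hOut_le_two (Adj := Adj) hV
  by_contra! hlt
  set g : V → ℝ := fun x => max (f x) 0 with hg
  have hg0 : ∀ x, 0 ≤ g x := fun x => le_max_right _ _
  have hE : ∑ y, ∑ x, (if Adj x y then (g x + (-1) * g y) ^ 2 else 0) ≤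
      (hOut Adj / 200) ^ 2 * ∑ x, g x ^ 2 := by
    have h1 : μ * ∑ x, g x ^ 2 ≤ ∑ y, g y * ∑ x, (if Adj x y then g x else 0) := by
      rw [Finset.mul_sum]
      refine Finset.sum_le_sum fun y _ => ?_
      have h2 : μ * g y ^ 2 = g y * (μ * f y) := by
        rcases le_total 0 (f y) with h | h
        · simp only [hg, max_eq_left h]; ring
        · simp only [hg, max_eq_right h]; ring
      rw [h2, ← hμ]
      refine mul_le_mul_of_nonneg_left (Finset.sum_le_sum fun x _ => ?_) (hg0 y)
      split_ifs
      · exact le_max_left _ _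
      · exact le_rfl
    rw [sum_adj_sq_eq hsymm hd g (-1) (by norm_num)]
    have hF : 0 ≤ ∑ x, g x ^ 2 := Finset.sum_nonneg fun _ _ => sq_nonneg _
    have := mul_le_mul_of_nonneg_right hlt.le hF
    linarith
  have hgne : ∃ x, g x ≠ 0 := ⟨x₀, (hx₀.trans_le (le_max_left _ _)).ne'⟩
  obtain ⟨t, ht0, ⟨x₁, hx₁⟩, ht⟩ :=
    exists_level_card_le Adj g (-1) (hOut Adj / 200) (by norm_num) (by positivity) hgne hE
  set S := Finset.univ.filter fun x => t < g x ^ 2 with hS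
  have hgpos : ∀ x, t < g x ^ 2 → 0 < g x := by
    intro x hx
    refine (hg0 x).lt_of_ne fun h => ?_
    rw [← h] at hx
    linarith
  have hScard : 2 * S.card ≤ Fintype.card V := by
    refine le_trans (Nat.mul_le_mul_left 2 (Finset.card_le_card fun x hx => ?_)) hcard
    simp only [hS, Finset.mem_filter, Finset.mem_univ, true_and] at hx ⊢
    simpa [hg] using hgpos x hx
  have hsub : outBd Adj S ⊆ Finset.univ.filter fun y =>
      ∃ x, Adj x y ∧ t < g x ^ 2 ∧ ¬ (t < g y ^ 2 ∧ -1 * (g x * g y) < 0) := by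
    intro y hy
    simp only [outBd, hS, Finset.mem_filter, Finset.mem_univ, true_and] at hy ⊢
    obtain ⟨hyS, x, hx, hxy⟩ := hy
    exact ⟨x, hxy, hx, fun h => hyS h.1⟩
  have h1 : ((outBd Adj S).card : ℝ) ≤ _ := (Nat.cast_le.2 (Finset.card_le_card hsub)).trans ht
  have h2 := hOut_mul_card_le (Adj := Adj) S hScard
  have hSpos : (0 : ℝ) < S.card := by
    exact_mod_cast Finset.card_pos.2 ⟨x₁, Finset.mem_filter.2 ⟨Finset.mem_univ _, hx₁⟩⟩
  have h3 := mul_le_mul_of_nonneg_right (sweep_constant_le hpos.le htwo) hSpos.le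
  have h4 := mul_pos hpos hSpos
  linarith

/-- Upper spectral bound, for eigenvectors orthogonal to the constants. -/
lemma hOut_sq_le_sub_eigenvalue (hsymm : ∀ x y, Adj x y → Adj y x)
    (hV : 2 ≤ Fintype.card V)
    (hd : ∀ x, (Finset.univ.filter fun y => Adj x y).card = d) (f : V → ℝ)
    (hf : ∃ x, f x ≠ 0) (hsum : ∑ x, f x = 0)
    (μ : ℝ) (hμ : ∀ y, ∑ x, (if Adj x y then f x else 0) = μ * f y) :
    hOut Adj ^ 2 / 80000 ≤ d - μ := by
  have hf' : ∃ x ∈ Finset.univ, f x ≠ 0 := by simpa using hf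
  obtain ⟨p, -, hp⟩ := Finset.exists_pos_of_sum_zero_of_exists_nonzero f hsum hf'
  obtain ⟨q, -, hq⟩ := Finset.exists_pos_of_sum_zero_of_exists_nonzero (fun x => -f x)
    (by rw [Finset.sum_neg_distrib, hsum, neg_zero]) (by simpa using hf)
  by_cases h : 2 * (Finset.univ.filter fun x => 0 < f x).card ≤ Fintype.card V
  · exact hOut_sq_le_sub_eigenvalue_of_card_pos_le hsymm hV hd f ⟨p, hp⟩ h μ hμ
  · refine hOut_sq_le_sub_eigenvalue_of_card_pos_le hsymm hV hd (fun x => -f x) ⟨q, hq⟩ ?_ μ ?_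
    · have hdisj : (Finset.univ.filter fun x => 0 < f x).card +
          (Finset.univ.filter fun x => 0 < -f x).card ≤ Fintype.card V := by
        rw [← Finset.card_union_of_disjoint]
        · exact Finset.card_le_univ _
        · rw [Finset.disjoint_left]
          intro x h1 h2
          simp only [Finset.mem_filter, Finset.mem_univ, true_and] at h1 h2
          linarith
      omega
    · intro y
      rw [mul_neg, ← hμ y, ← Finset.sum_neg_distrib]
      exact Finset.sum_congr rfl fun x _ => by split_ifs <;> simp

/-- An eigenvector of eigenvalue different from the degree is orthogonal to the constants. -/
lemma sum_eq_zero_of_eigenvalue_ne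
    (hd : ∀ x, (Finset.univ.filter fun y => Adj x y).card = d) (f : V → ℝ)
    (μ : ℝ) (hμ : ∀ y, ∑ x, (if Adj x y then f x else 0) = μ * f y) (hne : μ ≠ d) :
    ∑ x, f x = 0 := by
  have h1 : ∑ y, ∑ x, (if Adj x y then f x else 0) = μ * ∑ x, f x := by
    rw [Finset.mul_sum]
    exact Finset.sum_congr rfl fun y _ => hμ y
  have h2 : ∑ y, ∑ x, (if Adj x y then f x else 0) = d * ∑ x, f x := by
    rw [Finset.sum_comm, Finset.mul_sum]
    refine Finset.sum_congr rfl fun x _ => ?_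
    rw [← Finset.sum_filter, Finset.sum_const, hd, nsmul_eq_mul]
  have h3 : (μ - d) * ∑ x, f x = 0 := by linarith
  exact (mul_eq_zero.1 h3).resolve_left (sub_ne_zero.2 hne)

/-- Two orthogonal eigenvectors of the same eigenvalue combine to one orthogonal to the
constants. -/
lemma exists_eigenvector_sum_eq_zero (v w : V → ℝ) (hv : ∃ x, v x ≠ 0) (hw : ∃ x, w x ≠ 0)
    (hvw : ∑ x, v x * w x = 0) (μ : ℝ)
    (hμv : ∀ y, ∑ x, (if Adj x y then v x else 0) = μ * v y)
    (hμw : ∀ y, ∑ x, (if Adj x y then w x else 0) = μ * w y) :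
    ∃ f : V → ℝ, (∃ x, f x ≠ 0) ∧ ∑ x, f x = 0 ∧
      ∀ y, ∑ x, (if Adj x y then f x else 0) = μ * f y := by
  by_cases h0 : ∑ x, v x = 0
  · exact ⟨v, hv, h0, hμv⟩
  refine ⟨fun x => (∑ z, w z) * v x - (∑ z, v z) * w x, ?_, ?_, ?_⟩
  · by_contra! h
    have h1 : ∑ x, ((∑ z, w z) * v x - (∑ z, v z) * w x) * w x = 0 :=
      Finset.sum_eq_zero fun x _ => by rw [h x, zero_mul]
    have h2 : ∑ x, ((∑ z, w z) * v x - (∑ z, v z) * w x) * w x =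
        (∑ z, w z) * ∑ x, v x * w x - (∑ z, v z) * ∑ x, w x ^ 2 := by
      rw [Finset.mul_sum, Finset.mul_sum, ← Finset.sum_sub_distrib]
      exact Finset.sum_congr rfl fun x _ => by ring
    have hF : 0 < ∑ x, w x ^ 2 := by
      obtain ⟨x, hx⟩ := hw
      exact Finset.sum_pos' (fun _ _ => sq_nonneg _) ⟨x, Finset.mem_univ _, by positivity⟩
    rw [h2, hvw, mul_zero, zero_sub, neg_eq_zero] at h1
    exact (mul_ne_zero h0 hF.ne') h1
  · rw [Finset.sum_sub_distrib, ← Finset.mul_sum, ← Finset.mul_sum]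
    ring
  · intro y
    have h1 : ∀ x, (if Adj x y then (∑ z, w z) * v x - (∑ z, v z) * w x else 0) =
        (∑ z, w z) * (if Adj x y then v x else 0) - (∑ z, v z) * (if Adj x y then w x else 0) := by
      intro x
      split_ifs <;> simp
    simp only [h1, Finset.sum_sub_distrib, ← Finset.mul_sum, hμv, hμw]
    ring

end Spectral

/-- There are absolute constants `c, C > 0` such that for every non-bipartite finite
`d`-regular vertex-transitive graph, all eigenvalues of the normalized adjacency matrix
`(1/d)A`, listed in increasing order with multiplicity as `t₁ ≤ ⋯ ≤ t_N`, except possibly the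
largest one, lie in `[-1 + c h_out²/d, 1 - C h_out²/d]`. -/
theorem vertexTransitive_eigenvalue_interval :
    ∃ c > (0 : ℝ), ∃ C > (0 : ℝ),
      ∀ (V : Type) [Fintype V] (Adj : V → V → Prop),
        (∀ x y : V, Adj x y → Adj y x) →
        IsVertexTransitive Adj →
        ¬ Bipartite Adj →
        ∀ d : ℕ,
        (∀ x : V, (Finset.univ.filter fun y => Adj x y).card = d) →
        ∀ (hM : Matrix.IsHermitian
          ((d : ℝ)⁻¹ • Matrix.of (fun x y : V => if Adj x y then (1 : ℝ) else 0)))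
          (t : Fin (Fintype.card V) → ℝ),
        Monotone t →
        (∃ e : V ≃ Fin (Fintype.card V), ∀ x : V, t (e x) = hM.eigenvalues x) →
        ∀ i : Fin (Fintype.card V), (i : ℕ) < Fintype.card V - 1 →
          t i ∈ Set.Icc
            (-1 + c * hOut Adj ^ 2 / (d : ℝ))
            (1 - C * hOut Adj ^ 2 / (d : ℝ)) := by
  refine ⟨1 / 80000, by norm_num, 1 / 80000, by norm_num, ?_⟩
  intro V _ Adj hsymm hvt hnb d hd hM t ht ⟨e, he⟩ i hi
  have hV : 2 ≤ Fintype.card V := by omega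
  have hnorm : ∀ j, ∃ x, hM.eigenvectorBasis j x ≠ 0 := by
    intro j
    by_contra! h
    exact hM.eigenvectorBasis.orthonormal.ne_zero j (by ext x; simpa using h x)
  have horth : ∀ j k, j ≠ k →
      ∑ x, hM.eigenvectorBasis j x * hM.eigenvectorBasis k x = 0 := by
    intro j k hjk
    have : inner ℝ (hM.eigenvectorBasis j) (hM.eigenvectorBasis k) = 0 :=
      hM.eigenvectorBasis.orthonormal.2 hjk
    rw [PiLp.inner_apply] at this
    simpa [mul_comm] using this
  have heig : ∀ j y, (d : ℝ)⁻¹ * ∑ x, (if Adj x y then hM.eigenvectorBasis j x else 0) =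
      hM.eigenvalues j * hM.eigenvectorBasis j y := by
    intro j y
    have h1 := congrFun (hM.mulVec_eigenvectorBasis j) y
    rw [Matrix.smul_mulVec, Pi.smul_apply, Pi.smul_apply, smul_eq_mul, smul_eq_mul] at h1
    rw [← h1]
    congr 1
    simp only [Matrix.mulVec, dotProduct, Matrix.of_apply, ite_mul, one_mul, zero_mul]
    exact Finset.sum_congr rfl fun x _ => if_congr ⟨hsymm _ _, hsymm _ _⟩ rfl rfl
  have het : ∀ k, t k = hM.eigenvalues (e.symm k) := fun k => by
    rw [← he, Equiv.apply_symm_apply]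
  rcases Nat.eq_zero_or_pos d with rfl | hdpos
  · obtain ⟨x, hx⟩ := hnorm (e.symm i)
    have h1 := heig (e.symm i) x
    have h2 : ((0 : ℕ) : ℝ)⁻¹ = 0 := by rw [Nat.cast_zero, inv_zero]
    have h3 := (mul_eq_zero.1 (h1.symm.trans (mul_eq_zero_of_left h2 _))).resolve_right hx
    rw [het, h3]
    norm_num
  have hd0 : (0 : ℝ) < d := by exact_mod_cast hdpos
  have heig' : ∀ k y, ∑ x, (if Adj x y then hM.eigenvectorBasis (e.symm k) x else 0) =
      (d * t k) * hM.eigenvectorBasis (e.symm k) y := by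
    intro k y
    rw [het, mul_assoc, ← heig, mul_inv_cancel_left₀ hd0.ne']
  have hle : ∀ k, t k ≤ 1 := by
    intro k
    have h1 := (abs_le.1 (abs_eigenvalue_le hsymm hd _ (hnorm _) _ (heig' k))).2
    nlinarith
  have hlow := hOut_sq_le_add_eigenvalue hvt hsymm hV hnb hd _ (hnorm _) _ (heig' i)
  have hup : hOut Adj ^ 2 / 80000 ≤ d - d * t i := by
    by_cases h1 : t i = 1
    · set l : Fin (Fintype.card V) := ⟨Fintype.card V - 1, by omega⟩ with hl
      have hil : i ≠ l := fun h => by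
        rw [h, hl] at hi
        exact lt_irrefl _ hi
      have hl1 : t l = 1 := le_antisymm (hle l) (h1 ▸ ht (show i ≤ l from hi.le))
      obtain ⟨f, hf, hsum, hμ⟩ := exists_eigenvector_sum_eq_zero _ _ (hnorm (e.symm i))
        (hnorm (e.symm l)) (horth _ _ fun h => hil (e.symm.injective h)) (d * t i) (heig' i)
        ((h1.trans hl1.symm) ▸ heig' l)
      exact hOut_sq_le_sub_eigenvalue hsymm hV hd f hf hsum _ hμ
    · refine hOut_sq_le_sub_eigenvalue hsymm hV hd _ (hnorm _) ?_ _ (heig' i)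
      refine sum_eq_zero_of_eigenvalue_ne hd _ _ (heig' i) fun h => h1 ?_
      exact mul_left_cancel₀ hd0.ne' (h.trans (mul_one _).symm)
  rw [Set.mem_Icc]
  constructor
  · rw [← le_sub_iff_add_le', div_le_iff₀ hd0]
    linarith
  · rw [le_sub_comm, div_le_iff₀ hd0]
    linarith
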